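/- arXiv:2305.08164 — 5 statements merged into one kernel-verified Lean document; each statement's English description precedes it below -/
import Mathlib

section
/- Let d ≥ 2 and let α ∈ [1, ∞] with α ≠ 2. A matrix U ∈ ℝ^{d×d} satisfies ‖Ux‖_α = ‖x‖_α for all x ∈ ℝ^d if and only if U is a generalized permutation matrix with unit scalars, i.e., there exist a permutation π of {1,…,d} and signs s_1,…,s_d ∈ {−1, +1} such that (Ux)_i = s_i · x_{π(i)} for all x and all i. -/
/-- The defect of the parallelogram law for the function `|·| ^ p` on the real line. -/
noncomputable def parallelogramDefect (p a b : ℝ) : ℝ :=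
  2 * |a| ^ p + 2 * |b| ^ p - (|a + b| ^ p + |a - b| ^ p)

lemma parallelogramDefect_eq_zero_of_mul_eq_zero {p a b : ℝ} (hp : p ≠ 0) (h : a * b = 0) :
    parallelogramDefect p a b = 0 := by
  rcases mul_eq_zero.1 h with rfl | rfl <;>
    simp only [parallelogramDefect, zero_add, add_zero, zero_sub, sub_zero, abs_neg, abs_zero,
      Real.zero_rpow hp] <;> ring

lemma Real.abs_rpow_eq_sq_rpow (a p : ℝ) : |a| ^ p = (a ^ 2) ^ (p / 2) := by
  rw [← sq_abs, ← Real.rpow_natCast, ← Real.rpow_mul (abs_nonneg a)]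
  congr 1
  push_cast
  ring

lemma Real.add_rpow_lt_rpow_add_rpow {s t q : ℝ} (hs : 0 < s) (ht : 0 < t) (hq : q < 1) :
    (s + t) ^ q < s ^ q + t ^ q := by
  have key : ∀ u : ℝ, 0 < u → u ^ q = u * u ^ (q - 1) := fun u hu => by
    rw [mul_comm, ← Real.rpow_add_one hu.ne', sub_add_cancel]
  have h1 : (s + t) ^ (q - 1) < s ^ (q - 1) :=
    Real.rpow_lt_rpow_of_neg hs (by linarith) (by linarith)
  have h2 : (s + t) ^ (q - 1) < t ^ (q - 1) :=
    Real.rpow_lt_rpow_of_neg ht (by linarith) (by linarith)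
  rw [key _ (add_pos hs ht), key s hs, key t ht, add_mul]
  gcongr

lemma Real.rpow_add_rpow_lt_add_rpow {s t q : ℝ} (hs : 0 < s) (ht : 0 < t) (hq : 1 < q) :
    s ^ q + t ^ q < (s + t) ^ q := by
  have key : ∀ u : ℝ, 0 < u → u ^ q = u * u ^ (q - 1) := fun u hu => by
    rw [mul_comm, ← Real.rpow_add_one hu.ne', sub_add_cancel]
  have h1 : s ^ (q - 1) < (s + t) ^ (q - 1) :=
    Real.rpow_lt_rpow hs.le (by linarith) (by linarith)
  have h2 : t ^ (q - 1) < (s + t) ^ (q - 1) :=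
    Real.rpow_lt_rpow ht.le (by linarith) (by linarith)
  rw [key _ (add_pos hs ht), key s hs, key t ht, add_mul]
  gcongr

lemma parallelogramDefect_pos {p a b : ℝ} (hp : 0 < p) (hp2 : p < 2) (h : a * b ≠ 0) :
    0 < parallelogramDefect p a b := by
  obtain ⟨ha, hb⟩ := mul_ne_zero_iff.1 h
  have hadd := Real.add_rpow_lt_rpow_add_rpow (q := p / 2) (sq_pos_of_ne_zero ha)
    (sq_pos_of_ne_zero hb) (by linarith)
  have hconc := (Real.concaveOn_rpow (p := p / 2) (by linarith) (by linarith)).2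
    (Set.mem_Ici.2 (sq_nonneg (a + b))) (Set.mem_Ici.2 (sq_nonneg (a - b)))
    one_half_pos.le one_half_pos.le (add_halves 1)
  have hmean : (1 / 2 : ℝ) * (a + b) ^ 2 + 1 / 2 * (a - b) ^ 2 = a ^ 2 + b ^ 2 := by ring
  simp only [smul_eq_mul, hmean] at hconc
  simp only [parallelogramDefect, Real.abs_rpow_eq_sq_rpow _ p]
  linarith

lemma parallelogramDefect_neg {p a b : ℝ} (hp2 : 2 < p) (h : a * b ≠ 0) :
    parallelogramDefect p a b < 0 := by
  obtain ⟨ha, hb⟩ := mul_ne_zero_iff.1 h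
  have hadd := Real.rpow_add_rpow_lt_add_rpow (q := p / 2) (sq_pos_of_ne_zero ha)
    (sq_pos_of_ne_zero hb) (by linarith)
  have hconv := (convexOn_rpow (p := p / 2) (by linarith)).2
    (Set.mem_Ici.2 (sq_nonneg (a + b))) (Set.mem_Ici.2 (sq_nonneg (a - b)))
    one_half_pos.le one_half_pos.le (add_halves 1)
  have hmean : (1 / 2 : ℝ) * (a + b) ^ 2 + 1 / 2 * (a - b) ^ 2 = a ^ 2 + b ^ 2 := by ring
  simp only [smul_eq_mul, hmean] at hconv
  simp only [parallelogramDefect, Real.abs_rpow_eq_sq_rpow _ p]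
  linarith

/-- For `p ≠ 2`, the vectors `x` and `y` have disjoint supports as soon as they satisfy the
parallelogram law for the `p`-th power of the `ℓ_p` norm. -/
lemma mul_eq_zero_of_sum_parallelogramDefect_eq_zero {ι : Type*} [Fintype ι] {p : ℝ} (hp : 0 < p)
    (hp2 : p ≠ 2) {x y : ι → ℝ} (h : ∑ i, parallelogramDefect p (x i) (y i) = 0) (i : ι) :
    x i * y i = 0 := by
  by_contra hi
  rcases hp2.lt_or_gt with hlt | hgt
  · have hnonneg : ∀ l ∈ Finset.univ, 0 ≤ parallelogramDefect p (x l) (y l) := fun l _ => by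
      by_cases hl : x l * y l = 0
      · exact (parallelogramDefect_eq_zero_of_mul_eq_zero hp.ne' hl).ge
      · exact (parallelogramDefect_pos hp hlt hl).le
    exact (parallelogramDefect_pos hp hlt hi).ne'
      ((Finset.sum_eq_zero_iff_of_nonneg hnonneg).1 h i (Finset.mem_univ i))
  · have hnonpos : ∀ l ∈ Finset.univ, parallelogramDefect p (x l) (y l) ≤ 0 := fun l _ => by
      by_cases hl : x l * y l = 0
      · exact (parallelogramDefect_eq_zero_of_mul_eq_zero hp.ne' hl).le
      · exact (parallelogramDefect_neg hgt hl).le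
    exact (parallelogramDefect_neg hgt hi).ne
      ((Finset.sum_eq_zero_iff_of_nonpos hnonpos).1 h i (Finset.mem_univ i))

section PiLp

variable {ι : Type*} [Fintype ι] {α : ENNReal}

lemma PiLp.sum_abs_rpow_eq_norm_rpow (hα : 0 < α.toReal) (x : ι → ℝ) :
    ∑ i, |x i| ^ α.toReal = ‖WithLp.toLp α x‖ ^ α.toReal := by
  rw [PiLp.norm_eq_sum hα, ← Real.rpow_mul (by positivity), one_div_mul_cancel hα.ne',
    Real.rpow_one]
  rfl

lemma PiLp.sum_parallelogramDefect (hα : 0 < α.toReal) (x y : ι → ℝ) :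
    ∑ i, parallelogramDefect α.toReal (x i) (y i) =
      2 * ‖WithLp.toLp α x‖ ^ α.toReal + 2 * ‖WithLp.toLp α y‖ ^ α.toReal -
        (‖WithLp.toLp α (x + y)‖ ^ α.toReal + ‖WithLp.toLp α (x - y)‖ ^ α.toReal) := by
  simp only [parallelogramDefect, ← PiLp.sum_abs_rpow_eq_norm_rpow hα, Finset.sum_sub_distrib,
    Finset.sum_add_distrib, Finset.mul_sum, Pi.add_apply, Pi.sub_apply]

variable [Fact (1 ≤ α)]

lemma PiLp.norm_signed_perm (π : Equiv.Perm ι) {s : ι → ℝ} (hs : ∀ i, s i = 1 ∨ s i = -1)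
    (x : ι → ℝ) : ‖WithLp.toLp α (fun i => s i * x (π i))‖ = ‖WithLp.toLp α x‖ := by
  have habs : ∀ i, ‖s i * x (π i)‖ = ‖x (π i)‖ := fun i => by
    rcases hs i with h | h <;> simp [h]
  rcases eq_or_ne α ⊤ with rfl | htop
  · simp only [PiLp.norm_eq_ciSup, habs]
    exact π.iSup_comp (g := fun i => ‖x i‖)
  · have hpos : 0 < α.toReal :=
      ENNReal.toReal_pos (zero_lt_one.trans_le Fact.out).ne' htop
    simp only [PiLp.norm_eq_sum hpos, habs]
    rw [Equiv.sum_comp π (fun i => ‖x i‖ ^ α.toReal)]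

variable [DecidableEq ι] {U : Matrix ι ι ℝ}

lemma Matrix.norm_col_of_isometry
    (hU : ∀ x : ι → ℝ, ‖WithLp.toLp α (U.mulVec x)‖ = ‖WithLp.toLp α x‖) (j : ι) :
    ‖WithLp.toLp α (U.col j)‖ = 1 := by
  rw [← Matrix.mulVec_single_one, hU, PiLp.toLp_single, PiLp.norm_single, norm_one]

lemma Matrix.exists_row_entry_isolated_of_isometry_top
    (hU : ∀ x : ι → ℝ, ‖WithLp.toLp ⊤ (U.mulVec x)‖ = ‖WithLp.toLp ⊤ x‖) (j : ι) :
    ∃ i, U i j ≠ 0 ∧ ∀ k, k ≠ j → U i k = 0 := by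
  have hcol := Matrix.norm_col_of_isometry hU
  have hle : ∀ i k, ‖U i k‖ ≤ 1 := fun i k =>
    (PiLp.norm_apply_le (WithLp.toLp ⊤ (U.col k)) i).trans (hcol k).le
  have : Nonempty ι := ⟨j⟩
  obtain ⟨i, hi⟩ := exists_eq_ciSup_of_finite (f := fun i => ‖U i j‖)
  have hone : ‖U i j‖ = 1 := hi.trans ((PiLp.norm_eq_ciSup _).symm.trans (hcol j))
  refine ⟨i, norm_ne_zero_iff.1 (hone ▸ one_ne_zero), fun k hk => ?_⟩
  have hrow : ‖WithLp.toLp ⊤ (U i)‖ ≤ 1 := by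
    rw [PiLp.norm_eq_ciSup]
    exact ciSup_le (hle i)
  have hsum : ∑ l, U i l * U i l ≤ 1 :=
    (Real.le_norm_self _).trans
      ((PiLp.norm_apply_le (WithLp.toLp ⊤ (U.mulVec (U i))) i).trans ((hU (U i)).le.trans hrow))
  have hpair : U i j * U i j + U i k * U i k ≤ ∑ l, U i l * U i l := by
    rw [← Finset.sum_pair (f := fun l => U i l * U i l) hk.symm]
    exact Finset.sum_le_sum_of_subset_of_nonneg (Finset.subset_univ _)
      fun l _ _ => mul_self_nonneg _
  have hsq : U i j * U i j = 1 := by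
    rw [← abs_mul_abs_self, ← Real.norm_eq_abs, hone, one_mul]
  exact mul_self_eq_zero.1 (le_antisymm (by linarith) (mul_self_nonneg _))

lemma Matrix.exists_row_entry_isolated_of_isometry_of_ne_top (htop : α ≠ ⊤) (hα : α ≠ 2)
    (hU : ∀ x : ι → ℝ, ‖WithLp.toLp α (U.mulVec x)‖ = ‖WithLp.toLp α x‖) (j : ι) :
    ∃ i, U i j ≠ 0 ∧ ∀ k, k ≠ j → U i k = 0 := by
  have hpos : 0 < α.toReal := ENNReal.toReal_pos (zero_lt_one.trans_le Fact.out).ne' htop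
  have hp2 : α.toReal ≠ 2 := fun h => hα <| by
    rw [← ENNReal.ofReal_toReal htop, h, ENNReal.ofReal_ofNat]
  have hne : U.col j ≠ 0 := fun h => by
    have := Matrix.norm_col_of_isometry hU j
    simp [h] at this
  obtain ⟨i, hi⟩ := Function.ne_iff.1 hne
  refine ⟨i, hi, fun k hk => ?_⟩
  have hdefect : ∑ l, parallelogramDefect α.toReal (U.col j l) (U.col k l) = 0 := by
    rw [PiLp.sum_parallelogramDefect hpos, ← Matrix.mulVec_single_one, ← Matrix.mulVec_single_one,
      ← Matrix.mulVec_add, ← Matrix.mulVec_sub, hU, hU, hU, hU,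
      ← PiLp.sum_parallelogramDefect hpos]
    refine Finset.sum_eq_zero fun l _ =>
      parallelogramDefect_eq_zero_of_mul_eq_zero hpos.ne' ?_
    by_cases hl : l = j
    · subst hl
      simp [hk.symm]
    · simp [hl]
  exact (mul_eq_zero.1
    (mul_eq_zero_of_sum_parallelogramDefect_eq_zero hpos hp2 hdefect i)).resolve_left hi

lemma Matrix.exists_signed_perm_of_isometry (hα : α ≠ 2)
    (hU : ∀ x : ι → ℝ, ‖WithLp.toLp α (U.mulVec x)‖ = ‖WithLp.toLp α x‖) :
    ∃ (π : Equiv.Perm ι) (s : ι → ℝ), (∀ i, s i = 1 ∨ s i = -1) ∧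
      ∀ (x : ι → ℝ) (i : ι), U.mulVec x i = s i * x (π i) := by
  have hexists : ∀ j, ∃ i, U i j ≠ 0 ∧ ∀ k, k ≠ j → U i k = 0 := by
    rcases eq_or_ne α ⊤ with rfl | htop
    · exact Matrix.exists_row_entry_isolated_of_isometry_top hU
    · exact Matrix.exists_row_entry_isolated_of_isometry_of_ne_top htop hα hU
  choose f hf hzero using hexists
  have hinj : Function.Injective f := fun j k hjk => by
    by_contra hne
    exact hf j (hjk ▸ hzero k j hne)
  let e : Equiv.Perm ι := Equiv.ofBijective f (Finite.injective_iff_bijective.1 hinj)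
  have hrow : ∀ i k, k ≠ e.symm i → U i k = 0 := fun i k hk => by
    have := hzero (e.symm i) k hk
    rwa [show f (e.symm i) = i from e.apply_symm_apply i] at this
  refine ⟨e.symm, fun i => U i (e.symm i), fun i => ?_, fun x i => ?_⟩
  · have hcol : U.col (e.symm i) = Pi.single i (U i (e.symm i)) := by
      ext l
      rcases eq_or_ne l i with rfl | hl
      · simp
      · rw [Pi.single_eq_of_ne hl]
        exact hrow l _ fun h => hl (e.symm.injective h).symm
    have hnorm := Matrix.norm_col_of_isometry hU (e.symm i)
    rw [hcol, PiLp.toLp_single, PiLp.norm_single, Real.norm_eq_abs] at hnorm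
    exact eq_or_eq_neg_of_abs_eq hnorm
  · exact Finset.sum_eq_single (e.symm i)
      (fun k _ hk => mul_eq_zero_of_left (hrow i k hk) _)
      fun h => absurd (Finset.mem_univ _) h

end PiLp

/-- A matrix `U ∈ ℝ^{d×d}` (with `d ≥ 2`) preserves the `ℓ_α` norm for some
`α ∈ [1,∞]`, `α ≠ 2`, if and only if it is a generalized permutation matrix with
unit (±1) scalars. -/
theorem lp_isometry_matrix_iff_signed_perm
    (d : ℕ) (hd : 2 ≤ d) (α : ENNReal) [Fact (1 ≤ α)] (hα : α ≠ 2)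
    (U : Matrix (Fin d) (Fin d) ℝ) :
    (∀ x : Fin d → ℝ,
        ‖(WithLp.equiv α (Fin d → ℝ)).symm (U.mulVec x)‖ =
          ‖(WithLp.equiv α (Fin d → ℝ)).symm x‖) ↔
      ∃ (π : Equiv.Perm (Fin d)) (s : Fin d → ℝ),
        (∀ i, s i = 1 ∨ s i = -1) ∧
          ∀ (x : Fin d → ℝ) (i : Fin d), U.mulVec x i = s i * x (π i) := by
  refine ⟨Matrix.exists_signed_perm_of_isometry hα, ?_⟩
  rintro ⟨π, s, hs, h⟩ x
  rw [show U.mulVec x = fun i => s i * x (π i) from funext (h x)]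
  exact PiLp.norm_signed_perm π hs x
end

section
/- Let Z ⊂ ℝ^d be a compact set of positive Lebesgue measure |Z|, δ : Z × Z → [0,∞) a continuous metric on Z, μ > 0, and h : Z → Z continuous. Let z be uniformly distributed on Z, let z̃ given z have density p(z̃|z) = C_p(z)^{-1} e^{−δ(z,z̃)} with C_p(z) = ∫_Z e^{−δ(z,w)} dw, and let z_1^−, z_2^−, … be i.i.d. uniform on Z, independent of (z, z̃). Define for each M ∈ ℕ the contrastive loss L(M) = E[ −log( e^{−δ(h(z),h(z̃))/μ} / ( e^{−δ(h(z),h(z̃))/μ} + Σ_{i=1}^M e^{−δ(h(z),h(z_i^−))/μ} ) ) ]. Then lim_{M→∞} ( L(M) − log M ) + log |Z| = E_{z}[ H( p(·|z), q_h(·|z) ) ], where q_h(z̃|z) = C_h(z)^{-1} e^{−δ(h(z),h(z̃))/μ} with C_h(z) = ∫_Z e^{−δ(h(z),h(w))/μ} dw, and H(p, q) = −∫_Z p(w) log q(w) dw denotes the cross-entropy between densities p and q on Z. -/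
open MeasureTheory Filter

/-- The uniform probability measure on a set `Z` (normalized Lebesgue measure). -/
noncomputable def unifOn {d : ℕ} (Z : Set (Fin d → ℝ)) : Measure (Fin d → ℝ) :=
  (volume Z)⁻¹ • volume.restrict Z

/-- The contrastive loss `L(M)` with anchor `z` uniform on `Z`, positive sample `z̃`
drawn from the density `p(z̃|z) = C_p(z)⁻¹ exp(−δ(z,z̃))`, and `M` i.i.d. uniform
negative samples. -/
noncomputable def contrLoss {d : ℕ} (Z : Set (Fin d → ℝ))
    (δ : (Fin d → ℝ) → (Fin d → ℝ) → ℝ) (μ : ℝ)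
    (h : (Fin d → ℝ) → (Fin d → ℝ)) (M : ℕ) : ℝ :=
  ∫ z, (∫ ztil in Z,
      ((∫ w in Z, Real.exp (-δ z w))⁻¹ * Real.exp (-δ z ztil)) *
        (∫ zs : Fin M → (Fin d → ℝ),
          -Real.log (Real.exp (-δ (h z) (h ztil) / μ) /
            (Real.exp (-δ (h z) (h ztil) / μ) +
              ∑ i : Fin M, Real.exp (-δ (h z) (h (zs i)) / μ)))
          ∂(Measure.pi fun _ : Fin M => unifOn Z)))
    ∂(unifOn Z)

theorem abs_log_sub_log_le_div {c x y : ℝ} (hc : 0 < c) (hx : c ≤ x) (hy : c ≤ y) :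
    |Real.log x - Real.log y| ≤ |x - y| / c := by
  have key : ∀ {u v : ℝ}, c ≤ u → c ≤ v → Real.log u - Real.log v ≤ |u - v| / c := by
    intro u v hu hv
    have hu0 := hc.trans_le hu
    have hv0 := hc.trans_le hv
    calc Real.log u - Real.log v = Real.log (u / v) := (Real.log_div hu0.ne' hv0.ne').symm
      _ ≤ u / v - 1 := Real.log_le_sub_one_of_pos (div_pos hu0 hv0)
      _ = (u - v) / v := by field_simp
      _ ≤ |u - v| / v := by gcongr; exact le_abs_self _
      _ ≤ |u - v| / c := by gcongr
  rw [abs_le]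
  have h1 := key hx hy
  have h2 := key hy hx
  rw [abs_sub_comm] at h2
  constructor <;> linarith

theorem integral_abs_sum_sub_le_sqrt {X : Type*} [MeasurableSpace X] (ν : Measure X) [IsProbabilityMeasure ν] {f : X → ℝ}
    (hf : Measurable f) (hf0 : ∀ x, 0 ≤ f x) (hf1 : ∀ x, f x ≤ 1) {M : ℕ} (hM : 0 < M) :
    ∫ zs : Fin M → X, |∑ i, f (zs i) - M * ∫ x, f x ∂ν| ∂(Measure.pi fun _ => ν) ≤ √M := by
  have hM' : (0 : ℝ) < M := by exact_mod_cast hM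
  have hs : 0 < √(M : ℝ) := Real.sqrt_pos.2 hM'
  have hfb : ∀ x, ‖f x‖ ≤ 1 := fun x => by rw [Real.norm_of_nonneg (hf0 x)]; exact hf1 x
  have hfi : Integrable f ν := .of_bound hf.aestronglyMeasurable 1 (.of_forall hfb)
  set π : Measure (Fin M → X) := Measure.pi fun _ => ν
  have hmean : ∫ zs : Fin M → X, ∑ i, f (zs i) ∂π = M * ∫ x, f x ∂ν := by
    rw [integral_finsetSum _ fun i _ => integrable_comp_eval hfi]
    simp [integral_comp_eval (μ := fun _ : Fin M => ν) hf.aestronglyMeasurable]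
  have hmeas : Measurable fun zs : Fin M → X => ∑ i, f (zs i) := by fun_prop
  have hvar : ∫ zs : Fin M → X, (∑ i, f (zs i) - M * ∫ x, f x ∂ν) ^ 2 ∂π ≤ M := by
    rw [← hmean, ← ProbabilityTheory.variance_eq_integral hmeas.aemeasurable]
    have := ProbabilityTheory.variance_sum_pi (μ := fun _ : Fin M => ν) (X := fun _ => f)
      fun _ => MemLp.of_bound hf.aestronglyMeasurable 1 (.of_forall hfb)
    rw [show (fun zs : Fin M → X => ∑ i, f (zs i)) = ∑ i, fun zs : Fin M → X => f (zs i) by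
      ext; simp, this]
    have := ProbabilityTheory.variance_le_sq_of_bounded (μ := ν) (a := 0) (b := 1) (X := f)
      (.of_forall fun x => ⟨hf0 x, hf1 x⟩) hf.aemeasurable
    rw [Finset.sum_const, Finset.card_univ, Fintype.card_fin, nsmul_eq_mul]
    nlinarith
  have hint : Integrable (fun zs : Fin M → X => (∑ i, f (zs i) - M * ∫ x, f x ∂ν) ^ 2) π := by
    have hm : MemLp (fun zs : Fin M → X => ∑ i, f (zs i)) 2 π :=
      MemLp.of_bound hmeas.aestronglyMeasurable M <| .of_forall fun zs =>
        (norm_sum_le _ _).trans ((Finset.sum_le_sum fun i _ => hfb (zs i)).trans (by simp))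
    exact (hm.sub (memLp_const _)).integrable_sq
  calc ∫ zs : Fin M → X, |∑ i, f (zs i) - M * ∫ x, f x ∂ν| ∂π
      ≤ ∫ zs : Fin M → X, ((∑ i, f (zs i) - M * ∫ x, f x ∂ν) ^ 2 / √M + √M) / 2 ∂π := by
        refine integral_mono_of_nonneg (.of_forall fun _ => abs_nonneg _)
          (((hint.div_const _).add (integrable_const _)).div_const _) (.of_forall fun zs => ?_)
        dsimp only
        generalize ∑ i, f (zs i) - M * ∫ x, f x ∂ν = t
        rw [← sq_abs t, le_div_iff₀ two_pos, ← sub_nonneg]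
        have : |t| ^ 2 / √M + √M - |t| * 2 = (|t| - √M) ^ 2 / √M := by field_simp; ring
        rw [this]; positivity
    _ = ((∫ zs : Fin M → X, (∑ i, f (zs i) - M * ∫ x, f x ∂ν) ^ 2 ∂π) / √M + √M) / 2 := by
        rw [integral_div, integral_add (hint.div_const _) (integrable_const _), integral_div]
        simp
    _ ≤ (M / √M + √M) / 2 := by gcongr
    _ = √M := by rw [Real.div_sqrt]; ring

theorem abs_integral_neg_log_softmax_sub_le {X : Type*} [MeasurableSpace X] (ν : Measure X) [IsProbabilityMeasure ν] {f : X → ℝ}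
    (hf : Measurable f) {a c : ℝ} (hc : 0 < c) (hfc : ∀ x, c ≤ f x) (hf1 : ∀ x, f x ≤ 1)
    (ha0 : 0 < a) (ha1 : a ≤ 1) {M : ℕ} (hM : 0 < M) :
    |∫ zs : Fin M → X, -Real.log (a / (a + ∑ i, f (zs i))) ∂(Measure.pi fun _ => ν) - Real.log M
      - (Real.log (∫ x, f x ∂ν) - Real.log a)| ≤ (1 + √M) / (c * M) := by
  have hM' : (0 : ℝ) < M := by exact_mod_cast hM
  have hfi : Integrable f ν := .of_bound hf.aestronglyMeasurable 1 (.of_forall fun x => by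
    rw [Real.norm_of_nonneg (hc.le.trans (hfc x))]; exact hf1 x)
  have hm : c ≤ ∫ x, f x ∂ν := by
    simpa using integral_mono (integrable_const c) hfi hfc
  have hS : ∀ zs : Fin M → X, c * M ≤ ∑ i, f (zs i) := fun zs => by
    simpa [mul_comm] using Finset.sum_le_sum fun i (_ : i ∈ Finset.univ) => hfc (zs i)
  have hS1 : ∀ zs : Fin M → X, ∑ i, f (zs i) ≤ M := fun zs => by
    simpa using Finset.sum_le_sum fun i (_ : i ∈ Finset.univ) => hf1 (zs i)
  have hcM : 0 < c * M := by positivity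
  set m := ∫ x, f x ∂ν
  set π : Measure (Fin M → X) := Measure.pi fun _ => ν
  have hmeas : Measurable fun zs : Fin M → X => ∑ i, f (zs i) := by fun_prop
  have hpt : ∀ zs : Fin M → X, ‖-Real.log (a / (a + ∑ i, f (zs i))) -
      (Real.log M + (Real.log m - Real.log a))‖ ≤ (1 + |∑ i, f (zs i) - M * m|) / (c * M) := by
    intro zs
    have h1 := hS zs
    generalize ∑ i, f (zs i) = S at h1
    have hS0 : 0 < a + S := by linarith
    have : -Real.log (a / (a + S)) - (Real.log M + (Real.log m - Real.log a)) =
        Real.log ((a + S) / M) - Real.log m := by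
      rw [Real.log_div ha0.ne' hS0.ne', Real.log_div hS0.ne' hM'.ne']; ring
    rw [this, Real.norm_eq_abs]
    refine (abs_log_sub_log_le_div hc (by rw [le_div_iff₀ hM']; linarith) hm).trans ?_
    have : (a + S) / M - m = (a + (S - M * m)) / M := by field_simp; ring
    rw [this, abs_div, abs_of_pos hM', div_div, mul_comm (M : ℝ) c]
    gcongr
    exact (abs_add_le _ _).trans (by rw [abs_of_pos ha0]; linarith)
  have hgi : Integrable (fun zs : Fin M → X => |∑ i, f (zs i) - M * m|) π := by
    refine ((Integrable.of_bound hmeas.aestronglyMeasurable M (.of_forall fun zs => ?_)).sub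
      (integrable_const _)).abs
    rw [Real.norm_of_nonneg (hcM.le.trans (hS zs))]
    exact hS1 zs
  have hbi := ((integrable_const (1 : ℝ)).add hgi).div_const (c * M)
  have hFm : Measurable fun zs : Fin M → X => -Real.log (a / (a + ∑ i, f (zs i))) := by fun_prop
  have hDi : Integrable (fun zs : Fin M → X => -Real.log (a / (a + ∑ i, f (zs i))) -
      (Real.log M + (Real.log m - Real.log a))) π :=
    hbi.mono' (hFm.sub_const _).aestronglyMeasurable (.of_forall hpt)
  have hFi : Integrable (fun zs : Fin M → X => -Real.log (a / (a + ∑ i, f (zs i)))) π :=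
    (hDi.add (integrable_const (Real.log M + (Real.log m - Real.log a)))).congr
      (.of_forall fun _ => sub_add_cancel _ _)
  have heq : ∫ zs : Fin M → X, -Real.log (a / (a + ∑ i, f (zs i))) ∂π - Real.log M
      - (Real.log m - Real.log a) = ∫ zs : Fin M → X, (-Real.log (a / (a + ∑ i, f (zs i))) -
      (Real.log M + (Real.log m - Real.log a))) ∂π := by
    rw [integral_sub hFi (integrable_const _), integral_const]
    simp; ring
  rw [heq, ← Real.norm_eq_abs]
  refine (norm_integral_le_of_norm_le hbi (.of_forall hpt)).trans ?_
  simp only [Pi.add_apply]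
  rw [integral_div, integral_add (integrable_const _) hgi]
  gcongr
  · simp
  · exact integral_abs_sum_sub_le_sqrt ν hf (fun x => hc.le.trans (hfc x)) hf1 hM

theorem tendsto_integral_neg_log_softmax_sub_log {X : Type*} [MeasurableSpace X] (ρ : Measure X)
    [IsFiniteMeasure ρ] [NeZero ρ] {e g : X → X → ℝ} (he : Measurable (Function.uncurry e))
    (hg : Measurable (Function.uncurry g)) {c : ℝ} (hc : 0 < c) (hec : ∀ x y, c ≤ e x y)
    (he1 : ∀ x y, e x y ≤ 1) (hgc : ∀ x y, c ≤ g x y) (hg1 : ∀ x y, g x y ≤ 1) :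
    Tendsto (fun M : ℕ => (∫ x, (∫ y, ((∫ u, g x u ∂ρ)⁻¹ * g x y) *
        (∫ zs : Fin M → X, -Real.log (e x y / (e x y + ∑ i, e x (zs i)))
          ∂(Measure.pi fun _ => (ρ Set.univ)⁻¹ • ρ)) ∂ρ) ∂((ρ Set.univ)⁻¹ • ρ)) - Real.log M) atTop
      (nhds ((∫ x, -(∫ y, ((∫ u, g x u ∂ρ)⁻¹ * g x y) *
        Real.log ((∫ u, e x u ∂ρ)⁻¹ * e x y) ∂ρ) ∂((ρ Set.univ)⁻¹ • ρ))
          - Real.log (ρ Set.univ).toReal)) := by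
  set ν : Measure X := (ρ Set.univ)⁻¹ • ρ with hν
  have : IsProbabilityMeasure ν := isProbabilityMeasureSMul
  set V : ℝ := (ρ Set.univ).toReal
  have hV0 : 0 < V := ENNReal.toReal_pos (NeZero.ne _) (measure_ne_top _ _)
  have he0 : ∀ x y, 0 < e x y := fun x y => hc.trans_le (hec x y)
  have hg0 : ∀ x y, 0 < g x y := fun x y => hc.trans_le (hgc x y)
  have hex : ∀ x, Measurable (e x) := fun x => he.of_uncurry_left
  have hgx : ∀ x, Measurable (g x) := fun x => hg.of_uncurry_left
  have hei : ∀ x, Integrable (e x) ν := fun x =>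
    .of_bound (hex x).aestronglyMeasurable 1 (.of_forall fun y => by
      rw [Real.norm_of_nonneg (he0 x y).le]; exact he1 x y)
  have hgi : ∀ x, Integrable (g x) ρ := fun x =>
    .of_bound (hgx x).aestronglyMeasurable 1 (.of_forall fun y => by
      rw [Real.norm_of_nonneg (hg0 x y).le]; exact hg1 x y)
  have hG : ∀ x, c * V ≤ ∫ u, g x u ∂ρ := fun x => by
    simpa [mul_comm, V, measureReal_def] using integral_mono (integrable_const c) (hgi x) (hgc x)
  have hG0 : ∀ x, 0 < ∫ u, g x u ∂ρ := fun x => (mul_pos hc hV0).trans_le (hG x)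
  have hm : ∀ x, c ≤ ∫ u, e x u ∂ν := fun x => by
    simpa using integral_mono (integrable_const c) (hei x) (hec x)
  have hm1 : ∀ x, ∫ u, e x u ∂ν ≤ 1 := fun x => by
    simpa using integral_mono (hei x) (integrable_const 1) (he1 x)
  have heV : ∀ x, ∫ u, e x u ∂ρ = V * ∫ u, e x u ∂ν := fun x => by
    rw [hν, integral_smul_measure, ENNReal.toReal_inv, smul_eq_mul, mul_inv_cancel_left₀ hV0.ne']
  set r : X × X → ℝ := fun p => (∫ u, g p.1 u ∂ρ)⁻¹ * g p.1 p.2 with hr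
  set B : X × X → ℝ := fun p => Real.log (∫ u, e p.1 u ∂ν) - Real.log (e p.1 p.2) with hB
  set A : ℕ → X × X → ℝ := fun M p => ∫ zs : Fin M → X,
    -Real.log (e p.1 p.2 / (e p.1 p.2 + ∑ i, e p.1 (zs i))) ∂(Measure.pi fun _ => ν)
  have hr0 : ∀ p, 0 ≤ r p := fun p => mul_nonneg (inv_nonneg.2 (hG0 _).le) (hg0 _ _).le
  have hrm : Measurable r :=
    ((hg.stronglyMeasurable.integral_prod_right (ν := ρ)).measurable.comp measurable_fst).inv.mul hg
  have hBm : Measurable B :=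
    ((he.stronglyMeasurable.integral_prod_right (ν := ν)).measurable.comp measurable_fst).log.sub
      he.log
  have hAm : ∀ M, Measurable (A M) := fun M => by
    have h1 : Measurable fun q : (X × X) × (Fin M → X) => e q.1.1 q.1.2 := he.comp measurable_fst
    have h2 : ∀ i, Measurable fun q : (X × X) × (Fin M → X) => e q.1.1 (q.2 i) := fun i =>
      he.comp (f := fun q : (X × X) × (Fin M → X) => (q.1.1, q.2 i)) (by fun_prop)
    have h3 : Measurable fun q : (X × X) × (Fin M → X) =>
        -Real.log (e q.1.1 q.1.2 / (e q.1.1 q.1.2 + ∑ i, e q.1.1 (q.2 i))) := by fun_prop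
    exact h3.stronglyMeasurable.integral_prod_right'.measurable
  have hri : Integrable r (ν.prod ρ) := by
    refine .of_bound hrm.aestronglyMeasurable (c * V)⁻¹ (.of_forall fun p => ?_)
    rw [Real.norm_of_nonneg (hr0 p), ← mul_one (c * V)⁻¹]
    have := hG p.1
    have := hg1 p.1 p.2
    have := (hg0 p.1 p.2).le
    have := hG0 p.1
    simp only [hr]
    gcongr
  have hr1 : ∫ p, r p ∂(ν.prod ρ) = 1 := by
    rw [integral_prod _ hri]
    simp only [hr, integral_const_mul]
    simp [inv_mul_cancel₀ (hG0 _).ne']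
  have hrB : Integrable (fun p => r p * B p) (ν.prod ρ) := by
    refine hri.mul_bdd (c := -Real.log c) hBm.aestronglyMeasurable (.of_forall fun p => ?_)
    have h1 := Real.log_le_log hc (hm p.1)
    have h2 := Real.log_le_log hc (hec p.1 p.2)
    have h3 := Real.log_nonpos (hc.le.trans (hm p.1)) (hm1 p.1)
    have h4 := Real.log_nonpos (he0 p.1 p.2).le (he1 p.1 p.2)
    rw [Real.norm_eq_abs, abs_le]
    constructor <;> simp only [hB] <;> linarith
  have hlimit : (∫ x, -(∫ y, ((∫ u, g x u ∂ρ)⁻¹ * g x y) *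
      Real.log ((∫ u, e x u ∂ρ)⁻¹ * e x y) ∂ρ) ∂ν) - Real.log V = ∫ p, r p * B p ∂(ν.prod ρ) := by
    have h1 : ∀ x y, -(((∫ u, g x u ∂ρ)⁻¹ * g x y) * Real.log ((∫ u, e x u ∂ρ)⁻¹ * e x y)) =
        r (x, y) * B (x, y) + r (x, y) * Real.log V := fun x y => by
      have := hc.trans_le (hm x)
      rw [heV, Real.log_mul (by positivity) (he0 x y).ne', Real.log_inv,
        Real.log_mul hV0.ne' this.ne']
      simp only [hr, hB]
      ring
    simp_rw [← integral_neg, h1]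
    rw [← integral_prod (fun p => r p * B p + r p * Real.log V) (hrB.add (hri.mul_const _)),
      integral_add hrB (hri.mul_const _), integral_mul_const, hr1]
    ring
  have hD : ∀ M : ℕ, 0 < M → ∀ p, ‖A M p - Real.log M - B p‖ ≤ (1 + √M) / (c * M) :=
    fun M hM p => abs_integral_neg_log_softmax_sub_le ν (hex p.1) hc (hec p.1) (he1 p.1)
      (he0 p.1 p.2) (he1 p.1 p.2) hM
  have hbound : ∀ M : ℕ, 0 < M → ‖(∫ x, (∫ y, r (x, y) * A M (x, y) ∂ρ) ∂ν) - Real.log M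
      - ∫ p, r p * B p ∂(ν.prod ρ)‖ ≤ (1 + √M) / (c * M) := by
    intro M hM
    have hrD : Integrable (fun p => r p * (A M p - Real.log M - B p)) (ν.prod ρ) :=
      hri.mul_bdd (((hAm M).sub_const _).sub hBm).aestronglyMeasurable (.of_forall (hD M hM))
    have h1 : ∀ p, r p * A M p =
        r p * (A M p - Real.log M - B p) + r p * B p + r p * Real.log M := fun p => by ring
    have hrDB : Integrable (fun p => r p * (A M p - Real.log M - B p) + r p * B p) (ν.prod ρ) :=
      hrD.add hrB
    have hrA : Integrable (fun p => r p * A M p) (ν.prod ρ) := by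
      simp_rw [h1]
      exact hrDB.add (hri.mul_const _)
    rw [← integral_prod (fun p => r p * A M p) hrA]
    have h2 : ∫ p, r p * A M p ∂(ν.prod ρ) = ∫ p, r p * (A M p - Real.log M - B p) ∂(ν.prod ρ)
        + ∫ p, r p * B p ∂(ν.prod ρ) + Real.log M := by
      rw [integral_congr_ae (.of_forall h1), integral_add hrDB (hri.mul_const _),
        integral_add hrD hrB, integral_mul_const, hr1, one_mul]
    rw [h2, add_sub_cancel_right, add_sub_cancel_right]
    refine (norm_integral_le_of_norm_le (hri.mul_const ((1 + √M) / (c * M)))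
      (.of_forall fun p => ?_)).trans_eq (by rw [integral_mul_const, hr1, one_mul])
    rw [norm_mul, Real.norm_of_nonneg (hr0 p)]
    exact mul_le_mul_of_nonneg_left (hD M hM p) (hr0 p)
  have hrate : Tendsto (fun M : ℕ => (1 + √(M : ℝ)) / (c * M)) atTop (nhds 0) := by
    have h1 : Tendsto (fun M : ℕ => ((M : ℝ)⁻¹ + (√(M : ℝ))⁻¹) / c) atTop (nhds 0) := by
      have := ((tendsto_inv_atTop_zero.comp tendsto_natCast_atTop_atTop).add
        (tendsto_inv_atTop_zero.comp (Real.tendsto_sqrt_atTop.comp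
          (tendsto_natCast_atTop_atTop (R := ℝ))))).div_const c
      simpa using this
    refine h1.congr fun M => ?_
    rw [mul_comm c, ← div_div, add_div 1, Real.sqrt_div_self', one_div, one_div]
  rw [hlimit, tendsto_iff_norm_sub_tendsto_zero]
  exact squeeze_zero' (.of_forall fun _ => norm_nonneg _)
    ((eventually_gt_atTop 0).mono hbound) hrate

/-- As the number of negative samples `M → ∞`, the (normalized) contrastive loss
`L(M) − log M` converges, and the limit satisfies
`lim (L(M) − log M) + log |Z| = E_z[H(p(·|z), q_h(·|z))]`. -/
theorem contrastive_loss_tendsto_cross_entropy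
    (d : ℕ) (Z : Set (Fin d → ℝ)) (hZc : IsCompact Z) (hZpos : 0 < volume Z)
    (δ : (Fin d → ℝ) → (Fin d → ℝ) → ℝ)
    (hδnn : ∀ z ∈ Z, ∀ w ∈ Z, 0 ≤ δ z w)
    (hδself : ∀ z ∈ Z, δ z z = 0)
    (hδsymm : ∀ z ∈ Z, ∀ w ∈ Z, δ z w = δ w z)
    (hδtri : ∀ z ∈ Z, ∀ w ∈ Z, ∀ u ∈ Z, δ z u ≤ δ z w + δ w u)
    (hδsep : ∀ z ∈ Z, ∀ w ∈ Z, δ z w = 0 → z = w)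
    (hδcont : ContinuousOn (fun p : (Fin d → ℝ) × (Fin d → ℝ) => δ p.1 p.2) (Z ×ˢ Z))
    (μ : ℝ) (hμ : 0 < μ)
    (h : (Fin d → ℝ) → (Fin d → ℝ)) (hhcont : ContinuousOn h Z)
    (hhmaps : Set.MapsTo h Z Z) :
    Tendsto (fun M : ℕ => contrLoss Z δ μ h M - Real.log M) atTop
      (nhds
        ((∫ z, -(∫ w in Z,
            ((∫ u in Z, Real.exp (-δ z u))⁻¹ * Real.exp (-δ z w)) *
              Real.log ((∫ u in Z, Real.exp (-δ (h z) (h u) / μ))⁻¹ *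
                Real.exp (-δ (h z) (h w) / μ)))
          ∂(unifOn Z)) - Real.log (volume Z).toReal)) := by
  have hZm : MeasurableSet Z := hZc.isClosed.measurableSet
  classical
  obtain ⟨D, hD⟩ := (hZc.prod hZc).exists_bound_of_continuousOn hδcont
  have hδD : ∀ z ∈ Z, ∀ w ∈ Z, δ z w ≤ D := fun z hz w hw =>
    (le_abs_self _).trans (hD (z, w) ⟨hz, hw⟩)
  obtain ⟨z₀, hz₀⟩ : Z.Nonempty := nonempty_of_measure_ne_zero hZpos.ne'
  have hD0 : 0 ≤ D := (hδnn z₀ hz₀ z₀ hz₀).trans (hδD z₀ hz₀ z₀ hz₀)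
  have hexp_le : ∀ z ∈ Z, ∀ w ∈ Z, ∀ t : ℝ, 0 < t → Real.exp (-δ z w / t) ≤ 1 :=
    fun z hz w hw t ht => Real.exp_le_one_iff.2 <|
      div_nonpos_of_nonpos_of_nonneg (neg_nonpos.2 (hδnn z hz w hw)) ht.le
  set c : ℝ := min (Real.exp (-D)) (Real.exp (-D / μ))
  have hc0 : 0 < c := lt_min (Real.exp_pos _) (Real.exp_pos _)
  have hc1 : c ≤ 1 := (min_le_left _ _).trans (Real.exp_le_one_iff.2 (neg_nonpos.2 hD0))
  have hmaps : Set.MapsTo (fun p : (Fin d → ℝ) × (Fin d → ℝ) => (h p.1, h p.2)) (Z ×ˢ Z)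
      (Z ×ˢ Z) := fun p hp => ⟨hhmaps hp.1, hhmaps hp.2⟩
  have hhc : ContinuousOn (fun p : (Fin d → ℝ) × (Fin d → ℝ) => (h p.1, h p.2)) (Z ×ˢ Z) :=
    hhcont.prodMap hhcont
  set e : (Fin d → ℝ) → (Fin d → ℝ) → ℝ := fun z w => (Z ×ˢ Z).piecewise
    (fun p : (Fin d → ℝ) × (Fin d → ℝ) => Real.exp (-δ (h p.1) (h p.2) / μ)) (fun _ => 1) (z, w)
    with he
  set g : (Fin d → ℝ) → (Fin d → ℝ) → ℝ := fun z w => (Z ×ˢ Z).piecewise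
    (fun p : (Fin d → ℝ) × (Fin d → ℝ) => Real.exp (-δ p.1 p.2)) (fun _ => 1) (z, w) with hg
  have he_eq : ∀ z ∈ Z, ∀ w ∈ Z, e z w = Real.exp (-δ (h z) (h w) / μ) := fun z hz w hw =>
    Set.piecewise_eq_of_mem _ _ _ (show (z, w) ∈ Z ×ˢ Z from ⟨hz, hw⟩)
  have hg_eq : ∀ z ∈ Z, ∀ w ∈ Z, g z w = Real.exp (-δ z w) := fun z hz w hw =>
    Set.piecewise_eq_of_mem _ _ _ (show (z, w) ∈ Z ×ˢ Z from ⟨hz, hw⟩)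
  have hem : Measurable (Function.uncurry e) :=
    ((hδcont.comp hhc hmaps).neg.div_const μ).rexp.measurable_piecewise continuousOn_const
      (hZm.prod hZm)
  have hgm : Measurable (Function.uncurry g) :=
    hδcont.neg.rexp.measurable_piecewise continuousOn_const (hZm.prod hZm)
  have he_mem : ∀ z w, e z w ∈ Set.Icc c 1 := fun z w => by
    by_cases hp : (z, w) ∈ Z ×ˢ Z
    · rw [he_eq z hp.1 w hp.2]
      refine ⟨(min_le_right _ _).trans (Real.exp_le_exp.2 ?_),
        hexp_le _ (hhmaps hp.1) _ (hhmaps hp.2) μ hμ⟩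
      have := hδD _ (hhmaps hp.1) _ (hhmaps hp.2)
      gcongr
    · simp only [he, Set.piecewise_eq_of_notMem _ _ _ hp]
      exact ⟨hc1, le_rfl⟩
  have hg_mem : ∀ z w, g z w ∈ Set.Icc c 1 := fun z w => by
    by_cases hp : (z, w) ∈ Z ×ˢ Z
    · rw [hg_eq z hp.1 w hp.2]
      refine ⟨(min_le_left _ _).trans (Real.exp_le_exp.2 ?_), by
        simpa using hexp_le z hp.1 w hp.2 1 one_pos⟩
      have := hδD z hp.1 w hp.2
      gcongr
    · simp only [hg, Set.piecewise_eq_of_notMem _ _ _ hp]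
      exact ⟨hc1, le_rfl⟩
  have : IsFiniteMeasure (volume.restrict Z) := ⟨by simpa using hZc.measure_lt_top⟩
  have : NeZero (volume.restrict Z) := ⟨by simpa using hZpos.ne'⟩
  have hunif : unifOn Z = ((volume.restrict Z) Set.univ)⁻¹ • volume.restrict Z := by
    simp [unifOn]
  have : IsProbabilityMeasure (unifOn Z) := hunif ▸ isProbabilityMeasureSMul
  have hZae : ∀ᵐ z ∂(volume.restrict Z), z ∈ Z := ae_restrict_mem hZm
  have hunif_ae : ∀ᵐ z ∂(unifOn Z), z ∈ Z := Measure.ae_smul_measure hZae _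
  have key := tendsto_integral_neg_log_softmax_sub_log (volume.restrict Z) hem hgm hc0
    (fun z w => (he_mem z w).1) (fun z w => (he_mem z w).2) (fun z w => (hg_mem z w).1)
    (fun z w => (hg_mem z w).2)
  rw [← hunif, Measure.restrict_apply_univ] at key
  have hgint : ∀ z ∈ Z, ∫ u in Z, g z u = ∫ u in Z, Real.exp (-δ z u) := fun z hz =>
    integral_congr_ae (hZae.mono fun u hu => hg_eq z hz u hu)
  have heint : ∀ z ∈ Z, ∫ u in Z, e z u = ∫ u in Z, Real.exp (-δ (h z) (h u) / μ) :=
    fun z hz => integral_congr_ae (hZae.mono fun u hu => he_eq z hz u hu)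
  convert key using 3 with M
  · refine integral_congr_ae (hunif_ae.mono fun z hz => ?_)
    refine integral_congr_ae (hZae.mono fun w hw => ?_)
    simp only
    rw [hgint z hz, hg_eq z hz w hw]
    congr 1
    have hpi : ∀ᵐ zs ∂(Measure.pi fun _ : Fin M => unifOn Z), ∀ i, zs i ∈ Z :=
      eventually_all.2 fun i => Measure.tendsto_eval_ae_ae.eventually hunif_ae
    refine integral_congr_ae (hpi.mono fun zs hzs => ?_)
    simp only
    rw [he_eq z hz w hw, Finset.sum_congr rfl fun i _ => he_eq z hz (zs i) (hzs i)]
  · refine integral_congr_ae (hunif_ae.mono fun z hz => congrArg Neg.neg ?_)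
    refine integral_congr_ae (hZae.mono fun w hw => ?_)
    simp only
    rw [hgint z hz, heint z hz, hg_eq z hz w hw, he_eq z hz w hw]
end

section
/- Let Z ⊂ ℝ^d be a compact set of positive Lebesgue measure, δ : Z × Z → [0,∞) a continuous metric on Z, μ > 0, and h : Z → Z continuous. Define C_p(z) = ∫_Z e^{−δ(z,w)} dw and C_h(z) = ∫_Z e^{−δ(h(z),h(w))/μ} dw. If for all z, z̃ ∈ Z the conditional densities agree, i.e., C_p(z)^{-1} e^{−δ(z,z̃)} = C_h(z)^{-1} e^{−δ(h(z),h(z̃))/μ}, then C_p(z) = C_h(z) for all z ∈ Z and δ( h(z), h(z̃) ) = μ · δ( z, z̃ ) for all z, z̃ ∈ Z. -/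
open MeasureTheory

/-- If the ground-truth conditional density `C_p(z)⁻¹ exp(−δ(z,z̃))` and the model
conditional density `C_h(z)⁻¹ exp(−δ(h(z),h(z̃))/μ)` agree on all of `Z × Z`, then
the partition functions agree, `C_p = C_h` on `Z`, and `δ(h(z),h(z̃)) = μ · δ(z,z̃)`
for all `z, z̃ ∈ Z`. -/
theorem matching_conditionals_partition_and_scaled_metric
    (d : ℕ) (Z : Set (Fin d → ℝ)) (hZc : IsCompact Z) (hZpos : 0 < volume Z)
    (δ : (Fin d → ℝ) → (Fin d → ℝ) → ℝ)
    (hδnn : ∀ z ∈ Z, ∀ w ∈ Z, 0 ≤ δ z w)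
    (hδself : ∀ z ∈ Z, δ z z = 0)
    (hδsymm : ∀ z ∈ Z, ∀ w ∈ Z, δ z w = δ w z)
    (hδtri : ∀ z ∈ Z, ∀ w ∈ Z, ∀ u ∈ Z, δ z u ≤ δ z w + δ w u)
    (hδsep : ∀ z ∈ Z, ∀ w ∈ Z, δ z w = 0 → z = w)
    (hδcont : ContinuousOn (fun p : (Fin d → ℝ) × (Fin d → ℝ) => δ p.1 p.2) (Z ×ˢ Z))
    (μ : ℝ) (hμ : 0 < μ)
    (h : (Fin d → ℝ) → (Fin d → ℝ)) (hhcont : ContinuousOn h Z)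
    (hhmaps : Set.MapsTo h Z Z)
    (hmatch : ∀ z ∈ Z, ∀ ztil ∈ Z,
      (∫ w in Z, Real.exp (-δ z w))⁻¹ * Real.exp (-δ z ztil) =
        (∫ w in Z, Real.exp (-δ (h z) (h w) / μ))⁻¹ *
          Real.exp (-δ (h z) (h ztil) / μ)) :
    (∀ z ∈ Z, (∫ w in Z, Real.exp (-δ z w)) =
        ∫ w in Z, Real.exp (-δ (h z) (h w) / μ)) ∧
      ∀ z ∈ Z, ∀ ztil ∈ Z, δ (h z) (h ztil) = μ * δ z ztil := by
  have partition_eq : ∀ z ∈ Z, (∫ w in Z, Real.exp (-δ z w)) =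
      ∫ w in Z, Real.exp (-δ (h z) (h w) / μ) := by
    intro z hz
    have hm := hmatch z hz z hz
    rw [hδself z hz, hδself _ (hhmaps hz)] at hm
    simpa using hm
  refine ⟨partition_eq, fun z hz w hw => ?_⟩
  have hcont : ContinuousOn (fun w => Real.exp (-δ z w)) Z :=
    (hδcont.comp (continuousOn_const.prodMk continuousOn_id)
      fun w hw => Set.mk_mem_prod hz hw).neg.rexp
  have : NeZero (volume.restrict Z) := ⟨by simpa using hZpos.ne'⟩
  have hpos : 0 < ∫ w in Z, Real.exp (-δ z w) :=
    integral_exp_pos (hcont.integrableOn_compact hZc)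
  have hm := hmatch z hz w hw
  rw [← partition_eq z hz] at hm
  have hexp := Real.exp_injective (mul_left_cancel₀ (inv_ne_zero hpos.ne') hm)
  field_simp at hexp
  linarith
end

section
/- (Sinkhorn's theorem, existence) Let A ∈ ℝ^{d×d} have all entries strictly positive. Then there exist diagonal matrices D_1, D_2 ∈ ℝ^{d×d} with strictly positive diagonal entries such that D_1 A D_2 is doubly stochastic. -/
/-- The product of the coordinates of `x` divided by the product of the coordinates of `A x`. -/
noncomputable def prodRatio {n : Type*} [Fintype n] (A : Matrix n n ℝ) (x : n → ℝ) : ℝ :=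
  (∏ j, x j) / ∏ i, A.mulVec x i

lemma prodRatio_smul {n : Type*} [Fintype n] (A : Matrix n n ℝ) (x : n → ℝ) {s : ℝ}
    (hs : s ≠ 0) : prodRatio A (s • x) = prodRatio A x := by
  simp only [prodRatio, Matrix.mulVec_smul, Pi.smul_apply, smul_eq_mul, Finset.prod_mul_distrib,
    Finset.prod_const]
  exact mul_div_mul_left _ _ (pow_ne_zero _ hs)

lemma mulVec_pos_of_pos {n : Type*} [Fintype n] {A : Matrix n n ℝ} (hA : ∀ i j, 0 < A i j)
    {x : n → ℝ} (hx : ∀ j, 0 ≤ x j) (hsum : 0 < ∑ j, x j) (i : n) : 0 < A.mulVec x i := by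
  obtain ⟨j, hj, hxj⟩ : ∃ j ∈ Finset.univ, 0 < x j :=
    Finset.exists_lt_of_sum_lt (by simpa using hsum)
  exact Finset.sum_pos' (fun k _ => mul_nonneg (hA i k).le (hx k)) ⟨j, hj, mul_pos (hA i j) hxj⟩

lemma exists_pos_forall_prodRatio_le {n : Type*} [Fintype n] [Nonempty n] {A : Matrix n n ℝ}
    (hA : ∀ i j, 0 < A i j) :
    ∃ x : n → ℝ, (∀ j, 0 < x j) ∧
      ∀ y : n → ℝ, (∀ j, 0 < y j) → prodRatio A y ≤ prodRatio A x := by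
  classical
  have hpos : ∀ x ∈ stdSimplex ℝ n, 0 < ∏ i, A.mulVec x i := fun x hx =>
    Finset.prod_pos fun i _ => mulVec_pos_of_pos hA hx.1 (hx.2 ▸ one_pos) i
  have hcont : ContinuousOn (prodRatio A) (stdSimplex ℝ n) := by
    refine ContinuousOn.div (by fun_prop) (Continuous.continuousOn ?_) fun x hx => (hpos x hx).ne'
    exact continuous_finsetProd _ fun i _ =>
      (continuous_apply i).comp (Continuous.matrix_mulVec continuous_const continuous_id)
  have hne : (stdSimplex ℝ n).Nonempty := ⟨_, single_mem_stdSimplex ℝ (Classical.arbitrary n)⟩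
  obtain ⟨x, hx, hmax⟩ := (isCompact_stdSimplex ℝ n).exists_isMaxOn hne hcont
  have hle : ∀ y : n → ℝ, (∀ j, 0 < y j) → prodRatio A y ≤ prodRatio A x := by
    intro y hy
    have hs : 0 < ∑ j, y j := Finset.sum_pos (fun j _ => hy j) Finset.univ_nonempty
    rw [← prodRatio_smul A y (inv_ne_zero hs.ne')]
    refine hmax ⟨fun j => mul_nonneg (inv_nonneg.2 hs.le) (hy j).le, ?_⟩
    simp only [Pi.smul_apply, smul_eq_mul, ← Finset.mul_sum]
    exact inv_mul_cancel₀ hs.ne'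
  refine ⟨x, fun j => (hx.1 j).lt_of_ne' fun hj => ?_, hle⟩
  have h1 := hle (fun _ => 1) fun _ => one_pos
  have h0 : prodRatio A x = 0 := by
    rw [prodRatio, Finset.prod_eq_zero (Finset.mem_univ j) hj, zero_div]
  have h2 : 0 < prodRatio A fun _ => 1 := by
    refine div_pos (by simp) (Finset.prod_pos fun i _ => mulVec_pos_of_pos hA ?_ ?_ i)
    · exact fun _ => zero_le_one
    · exact Finset.sum_pos (fun _ _ => one_pos) Finset.univ_nonempty
  linarith

lemma sum_div_mulVec_eq_inv_of_forall_prodRatio_le {n : Type*} [Fintype n]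
    {A : Matrix n n ℝ} (hA : ∀ i j, 0 < A i j) {x : n → ℝ} (hx : ∀ j, 0 < x j)
    (hmax : ∀ y : n → ℝ, (∀ j, 0 < y j) → prodRatio A y ≤ prodRatio A x) (k : n) :
    ∑ i, A i k / A.mulVec x i = (x k)⁻¹ := by
  classical
  have hmulVec : ∀ y : n → ℝ, (∀ j, 0 < y j) → ∀ i, 0 < A.mulVec y i := fun y hy =>
    mulVec_pos_of_pos hA (fun j => (hy j).le)
      (Finset.sum_pos (fun j _ => hy j) ⟨k, Finset.mem_univ k⟩)
  have hlog : ∀ y : n → ℝ, (∀ j, 0 < y j) →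
      Real.log (prodRatio A y) = ∑ j, Real.log (y j) - ∑ i, Real.log (A.mulVec y i) := by
    intro y hy
    rw [prodRatio, Real.log_div (Finset.prod_pos fun j _ => hy j).ne'
      (Finset.prod_pos fun i _ => hmulVec y hy i).ne',
      Real.log_prod fun j _ => (hy j).ne', Real.log_prod fun i _ => (hmulVec y hy i).ne']
  let p : ℝ → n → ℝ := fun t => x + t • Pi.single k 1
  have hp0 : p 0 = x := by simp [p]
  have hpcont : Continuous p := by fun_prop
  have hppos : ∀ᶠ t in nhds 0, ∀ j, 0 < p t j := by
    refine Filter.eventually_all.2 fun j => ?_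
    exact ((continuous_apply j).comp hpcont).continuousAt.eventually
      (lt_mem_nhds (by simpa [hp0] using hx j))
  have hlocal : IsLocalMax
      (fun t => ∑ j, Real.log (p t j) - ∑ i, Real.log (A.mulVec (p t) i)) 0 := by
    filter_upwards [hppos] with t ht
    rw [hp0, ← hlog _ ht, ← hlog _ hx]
    exact Real.log_le_log (div_pos (Finset.prod_pos fun j _ => ht j)
      (Finset.prod_pos fun i _ => hmulVec _ ht i)) (hmax _ ht)
  have hd1 : ∀ j, HasDerivAt (fun t => p t j) ((Pi.single k 1 : n → ℝ) j) 0 := fun j => by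
    simpa [p] using ((hasDerivAt_id (0 : ℝ)).mul_const ((Pi.single k 1 : n → ℝ) j)).const_add (x j)
  have hd2 : ∀ i, HasDerivAt (fun t => A.mulVec (p t) i) (A i k) 0 := fun i => by
    simpa [p, Matrix.mulVec_add, Matrix.mulVec_smul] using
      ((hasDerivAt_id (0 : ℝ)).mul_const (A i k)).const_add (A.mulVec x i)
  have hderiv := (HasDerivAt.fun_sum fun j (_ : j ∈ Finset.univ) =>
      (hd1 j).log (by simpa [hp0] using (hx j).ne')).fun_sub
    (HasDerivAt.fun_sum fun i (_ : i ∈ Finset.univ) =>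
      (hd2 i).log (by simpa [hp0] using (hmulVec x hx i).ne'))
  have h := hlocal.hasDerivAt_eq_zero hderiv
  rw [hp0, Finset.sum_eq_single k (fun j _ hj => by simp [hj]) (by simp)] at h
  simp only [Pi.single_eq_same, one_div] at h
  linarith


/-- Sinkhorn's theorem (existence): every strictly positive square matrix `A` can
be scaled by diagonal matrices `D₁, D₂` with strictly positive diagonal entries so
that `D₁ A D₂` is doubly stochastic. -/
theorem sinkhorn_exists
    (d : ℕ) (A : Matrix (Fin d) (Fin d) ℝ) (hA : ∀ i j, 0 < A i j) :
    ∃ c r : Fin d → ℝ, (∀ i, 0 < c i) ∧ (∀ i, 0 < r i) ∧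
      (∀ i j, 0 ≤ (Matrix.diagonal c * A * Matrix.diagonal r) i j) ∧
      (∀ i, (∑ j, (Matrix.diagonal c * A * Matrix.diagonal r) i j) = 1) ∧
      (∀ j, (∑ i, (Matrix.diagonal c * A * Matrix.diagonal r) i j) = 1) := by
  obtain rfl | hd := Nat.eq_zero_or_pos d
  · exact ⟨fun _ => 1, fun _ => 1, by simp, by simp, by simp, by simp, by simp⟩
  have : Nonempty (Fin d) := ⟨⟨0, hd⟩⟩
  obtain ⟨x, hx, hmax⟩ := exists_pos_forall_prodRatio_le hA
  have hAx : ∀ i, 0 < A.mulVec x i := mulVec_pos_of_pos hA (fun j => (hx j).le)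
    (Finset.sum_pos (fun j _ => hx j) Finset.univ_nonempty)
  refine ⟨fun i => (A.mulVec x i)⁻¹, x, fun i => inv_pos.2 (hAx i), hx, ?_, ?_, ?_⟩ <;>
    simp only [Matrix.mul_diagonal, Matrix.diagonal_mul]
  · exact fun i j => mul_nonneg (mul_nonneg (inv_nonneg.2 (hAx i).le) (hA i j).le) (hx j).le
  · intro i
    simp only [mul_assoc, ← Finset.mul_sum]
    exact inv_mul_cancel₀ (hAx i).ne'
  · intro j
    have h := sum_div_mulVec_eq_inv_of_forall_prodRatio_le hA hx hmax j
    simp only [div_eq_inv_mul] at h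
    rw [← Finset.sum_mul, h, inv_mul_cancel₀ (hx j).ne']
end

section
/- (Sinkhorn's theorem, uniqueness) Let A ∈ ℝ^{d×d} have all entries strictly positive, and suppose D_1, D_2 and D_1', D_2' are two pairs of diagonal matrices with strictly positive diagonal entries such that both D_1 A D_2 and D_1' A D_2' are doubly stochastic. Then there exists a constant c > 0 such that D_1' = c·D_1 and D_2' = c^{-1}·D_2; in particular D_1 A D_2 = D_1' A D_2'. -/
/-- If a positive doubly stochastic matrix `B` remains doubly stochastic after scaling its rows by
`r` and its columns by `s`, with `r` and `s` positive, then `r` is constant and `s` is constantly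
its inverse. -/
theorem exists_const_of_scaling_doublyStochastic {n : Type*} [Fintype n] [Nonempty n]
    {B : n → n → ℝ} {r s : n → ℝ} (hB : ∀ i j, 0 < B i j)
    (hr : ∀ i, 0 < r i) (hs : ∀ j, 0 < s j)
    (hrow : ∀ i, ∑ j, B i j = 1) (hcol : ∀ j, ∑ i, B i j = 1)
    (hrow' : ∀ i, ∑ j, r i * B i j * s j = 1) (hcol' : ∀ j, ∑ i, r i * B i j * s j = 1) :
    ∃ c : ℝ, 0 < c ∧ (∀ i, r i = c) ∧ ∀ j, s j = c⁻¹ := by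
  obtain ⟨k, hk⟩ := Finite.exists_min r
  have hle (j : n) : r k * s j ≤ 1 := by
    calc r k * s j = ∑ i, r k * B i j * s j := by
          rw [← Finset.sum_mul, ← Finset.mul_sum, hcol, mul_one]
      _ ≤ ∑ i, r i * B i j * s j := by
          refine Finset.sum_le_sum fun i _ => ?_
          exact mul_le_mul_of_nonneg_right
            (mul_le_mul_of_nonneg_right (hk i) (hB i j).le) (hs j).le
      _ = 1 := hcol' j
  have heq : ∀ j, B k j * (1 - r k * s j) = 0 := by
    have hsum : ∑ j, B k j * (1 - r k * s j) = 0 := by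
      calc ∑ j, B k j * (1 - r k * s j) = ∑ j, (B k j - r k * B k j * s j) :=
            Finset.sum_congr rfl fun j _ => by ring
        _ = 0 := by rw [Finset.sum_sub_distrib, hrow, hrow', sub_self]
    have hnonneg : ∀ j ∈ Finset.univ, 0 ≤ B k j * (1 - r k * s j) :=
      fun j _ => mul_nonneg (hB k j).le (sub_nonneg.2 (hle j))
    exact fun j => (Finset.sum_eq_zero_iff_of_nonneg hnonneg).1 hsum j (Finset.mem_univ j)
  have hs_eq (j : n) : s j = (r k)⁻¹ := by
    have h := (mul_eq_zero.1 (heq j)).resolve_left (hB k j).ne'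
    exact eq_inv_of_mul_eq_one_right (sub_eq_zero.1 h).symm
  refine ⟨r k, hr k, fun i => ?_, hs_eq⟩
  have h := hrow' i
  simp only [hs_eq] at h
  rw [← Finset.sum_mul, ← Finset.mul_sum, hrow, mul_one] at h
  exact (mul_inv_eq_one₀ (hr k).ne').1 h

/-- Entries of a matrix multiplied by diagonal matrices on both sides. -/
theorem Matrix.IsDiag.mul_mul_apply {n R : Type*} [Fintype n] [DecidableEq n] [Semiring R]
    {D E : Matrix n n R} (hD : D.IsDiag) (hE : E.IsDiag) (A : Matrix n n R) (i j : n) :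
    (D * A * E) i j = D i i * A i j * E j j := by
  conv_lhs => rw [← hD.diagonal_diag, ← hE.diagonal_diag]
  rw [Matrix.mul_diagonal, Matrix.diagonal_mul, Matrix.diag_apply, Matrix.diag_apply]

/-- Sinkhorn's theorem (uniqueness): if two pairs of diagonal matrices with
strictly positive diagonal entries both scale a strictly positive matrix `A` to a
doubly stochastic matrix, then the pairs agree up to a positive constant
`c` (namely `D₁' = c D₁`, `D₂' = c⁻¹ D₂`); in particular the two doubly
stochastic scalings coincide. -/
theorem sinkhorn_unique
    (d : ℕ) (A : Matrix (Fin d) (Fin d) ℝ) (hA : ∀ i j, 0 < A i j)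
    (D₁ D₂ D₁' D₂' : Matrix (Fin d) (Fin d) ℝ)
    (hD₁ : D₁.IsDiag) (hD₂ : D₂.IsDiag) (hD₁' : D₁'.IsDiag) (hD₂' : D₂'.IsDiag)
    (hD₁pos : ∀ i, 0 < D₁ i i) (hD₂pos : ∀ i, 0 < D₂ i i)
    (hD₁'pos : ∀ i, 0 < D₁' i i) (hD₂'pos : ∀ i, 0 < D₂' i i)
    (h1 : (∀ i j, 0 ≤ (D₁ * A * D₂) i j) ∧ (∀ i, (∑ j, (D₁ * A * D₂) i j) = 1) ∧
      (∀ j, (∑ i, (D₁ * A * D₂) i j) = 1))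
    (h2 : (∀ i j, 0 ≤ (D₁' * A * D₂') i j) ∧ (∀ i, (∑ j, (D₁' * A * D₂') i j) = 1) ∧
      (∀ j, (∑ i, (D₁' * A * D₂') i j) = 1)) :
    ∃ c : ℝ, 0 < c ∧ D₁' = c • D₁ ∧ D₂' = c⁻¹ • D₂ ∧ D₁ * A * D₂ = D₁' * A * D₂' := by
  rcases isEmpty_or_nonempty (Fin d) with hd | hd
  · exact ⟨1, one_pos, Subsingleton.elim _ _, Subsingleton.elim _ _, Subsingleton.elim _ _⟩
  obtain ⟨-, hrow, hcol⟩ := h1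
  obtain ⟨-, hrow', hcol'⟩ := h2
  simp only [hD₁.mul_mul_apply hD₂] at hrow hcol
  simp only [hD₁'.mul_mul_apply hD₂'] at hrow' hcol'
  have hscale (i j : Fin d) : D₁' i i / D₁ i i * (D₁ i i * A i j * D₂ j j) * (D₂' j j / D₂ j j) =
      D₁' i i * A i j * D₂' j j := by
    have := (hD₁pos i).ne'
    have := (hD₂pos j).ne'
    field_simp
  obtain ⟨c, hc, hr, hs⟩ := exists_const_of_scaling_doublyStochastic
    (B := fun i j => D₁ i i * A i j * D₂ j j)
    (r := fun i => D₁' i i / D₁ i i) (s := fun j => D₂' j j / D₂ j j)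
    (fun i j => mul_pos (mul_pos (hD₁pos i) (hA i j)) (hD₂pos j))
    (fun i => div_pos (hD₁'pos i) (hD₁pos i)) (fun j => div_pos (hD₂'pos j) (hD₂pos j))
    hrow hcol (by simpa only [hscale] using hrow') (by simpa only [hscale] using hcol')
  have e₁ : D₁' = c • D₁ := by
    ext i j
    rcases eq_or_ne i j with rfl | hij
    · exact (div_eq_iff (hD₁pos i).ne').1 (hr i)
    · simp [hD₁ hij, hD₁' hij]
  have e₂ : D₂' = c⁻¹ • D₂ := by
    ext i j
    rcases eq_or_ne i j with rfl | hij
    · exact (div_eq_iff (hD₂pos i).ne').1 (hs i)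
    · simp [hD₂ hij, hD₂' hij]
  refine ⟨c, hc, e₁, e₂, ?_⟩
  rw [e₁, e₂, Matrix.smul_mul, Matrix.smul_mul, Matrix.mul_smul, smul_smul,
    mul_inv_cancel₀ hc.ne', one_smul]
end
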